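/- arXiv:2102.05861 — 2 statements merged into one kernel-verified Lean document; each statement's English description precedes it below -/
import Mathlib

section
/- (Theorem 2, case (h1).) Let {e_n} be a sequence in H and {α_n} ⊆ (0,1], {β_n} ⊆ [0,1] real sequences such that: (i) α_n → 0 and ∑ α_n = +∞; (ii) 0 < liminf β_n ≤ limsup β_n < 1; (iii) ∑ ‖e_n‖ < +∞ or ‖e_n‖/α_n → 0. Then for every x_0 ∈ Q, the sequence {x_n} generated by x_{n+1} = β_n x_n + (1 − β_n) P_Q(α_n f(x_n) + (T x_n − α_n F(T x_n)) + e_n) converges strongly to q*, the unique point of C = Fix(T) satisfying ⟨F(q*) − f(q*), x − q*⟩ ≥ 0 for all x ∈ C. -/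
open scoped RealInnerProductSpace
open Filter

/-- A bounded family in a real Hilbert space converges weakly along any ultrafilter. -/
theorem exists_weak_limit_of_bounded
    {H ι : Type*} [NormedAddCommGroup H] [InnerProductSpace ℝ H] [CompleteSpace H]
    (U : Ultrafilter ι) (x : ι → H) (R : ℝ) (hx : ∀ i, ‖x i‖ ≤ R) :
    ∃ p : H, ∀ v, Tendsto (fun i => ⟪x i, v⟫) U (nhds ⟪p, v⟫) := by
  let φ : ι → WeakDual ℝ H := fun i =>
    StrongDual.toWeakDual (InnerProductSpace.toDual ℝ H (x i))
  have hK := WeakDual.isCompact_closedBall (𝕜 := ℝ) (0 : StrongDual ℝ H) R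
  have hmem : ∀ i, φ i ∈ WeakDual.toStrongDual ⁻¹' Metric.closedBall (0 : StrongDual ℝ H) R := by
    intro i
    simpa [φ] using hx i
  obtain ⟨ψ, -, hψ⟩ := hK.ultrafilter_le_nhds (U.map φ)
    (le_principal_iff.2 (Eventually.of_forall hmem : ∀ᶠ i in (U : Filter ι), _))
  refine ⟨(InnerProductSpace.toDual ℝ H).symm (WeakDual.toStrongDual ψ), fun v => ?_⟩
  have hφ : Tendsto φ U (nhds ψ) := hψ
  have h := ((WeakDual.eval_continuous v).tendsto ψ).comp hφ
  simpa [φ, Function.comp_def] using h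

/-- Obtuse-angle form of nonexpansiveness of the metric projection. -/
theorem norm_sq_proj_sub_le {H : Type*} [NormedAddCommGroup H] [InnerProductSpace ℝ H]
    {u y q : H} (h : ⟪u - y, q - y⟫ ≤ 0) : ‖y - q‖ ^ 2 ≤ ⟪u - q, y - q⟫ := by
  have h1 : u - q = (u - y) + (y - q) := by abel
  have h2 : y - q = -(q - y) := by abel
  rw [h1, inner_add_left, real_inner_self_eq_norm_sq]
  nth_rewrite 2 [h2]
  rw [inner_neg_right]
  linarith

/-- Quantitative demiclosedness: bounded approximate fixed points of a nonexpansive map almost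
satisfy every linear inequality that holds on its fixed-point set. -/
theorem exists_inner_le_of_approx_fixed
    {H : Type*} [NormedAddCommGroup H] [InnerProductSpace ℝ H] [CompleteSpace H]
    {Q : Set H} {T PQ : H → H}
    (hT : ∀ x ∈ Q, ∀ y ∈ Q, ‖T x - T y‖ ≤ ‖x - y‖)
    (hPQ : ∀ x : H, PQ x ∈ Q ∧ ∀ y ∈ Q, ⟪x - PQ x, y - PQ x⟫ ≤ 0)
    {w z : H} (hw : ∀ p ∈ Q, T p = p → ⟪w, p - z⟫ ≤ 0) (R : ℝ) {ε : ℝ} (hε : 0 < ε) :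
    ∃ θ > 0, ∀ x ∈ Q, ‖x - z‖ ≤ R → ‖x - T x‖ ≤ θ → ⟪w, x - z⟫ ≤ ε := by
  by_contra! hcon
  choose x hxQ hxR hxT hxw using fun n : ℕ => hcon (1 / ((n : ℝ) + 1)) (by positivity)
  let U : Ultrafilter ℕ := hyperfilter ℕ
  have hU : (U : Filter ℕ) ≤ atTop := Nat.hyperfilter_le_atTop
  obtain ⟨d, hd⟩ := exists_weak_limit_of_bounded U (fun n => x n - z) R hxR
  set p := d + z with hp
  have hlim : ∀ v, Tendsto (fun n => ⟪x n - p, v⟫) U (nhds 0) := by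
    intro v
    have h := (hd v).sub_const ⟪d, v⟫
    rw [sub_self] at h
    refine h.congr fun n => ?_
    rw [← inner_sub_left, hp]
    congr 1
    abel
  have hpQ : p ∈ Q := by
    have h1 : ∀ n, ⟪x n - p, p - PQ p⟫ ≤ -‖p - PQ p‖ ^ 2 := by
      intro n
      have h := (hPQ p).2 (x n) (hxQ n)
      have h2 : x n - PQ p = (x n - p) + (p - PQ p) := by abel
      rw [h2, inner_add_right, real_inner_self_eq_norm_sq, real_inner_comm] at h
      linarith
    have h2 : (0 : ℝ) ≤ -‖p - PQ p‖ ^ 2 := le_of_tendsto' (hlim _) h1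
    have h3 : ‖p - PQ p‖ = 0 := by nlinarith [norm_nonneg (p - PQ p)]
    rw [sub_eq_zero.1 (norm_eq_zero.1 h3)]
    exact (hPQ p).1
  have hpT : T p = p := by
    set B := R + ‖d‖
    have hB : ∀ n, ‖x n - p‖ ≤ B := by
      intro n
      have h2 : x n - p = (x n - z) - d := by rw [hp]; abel
      rw [h2]
      exact (norm_sub_le _ _).trans (by linarith [hxR n])
    have h1 : ∀ n, ‖p - T p‖ ^ 2 ≤
        2 * B * ‖x n - T (x n)‖ + ‖x n - T (x n)‖ ^ 2 - 2 * ⟪x n - p, p - T p⟫ := by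
      intro n
      have h2 : x n - T p = (x n - p) + (p - T p) := by abel
      have h3 : ‖x n - T p‖ ≤ ‖x n - T (x n)‖ + ‖x n - p‖ := by
        have h4 : x n - T p = (x n - T (x n)) + (T (x n) - T p) := by abel
        rw [h4]
        exact (norm_add_le _ _).trans (by linarith [hT _ (hxQ n) _ hpQ])
      have h5 := norm_add_sq_real (x n - p) (p - T p)
      rw [← h2] at h5
      have h6 : ‖x n - T p‖ ^ 2 ≤ (‖x n - T (x n)‖ + ‖x n - p‖) ^ 2 := by gcongr
      nlinarith [mul_le_mul_of_nonneg_right (hB n) (norm_nonneg (x n - T (x n)))]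
    have h0 : Tendsto (fun n => ‖x n - T (x n)‖) U (nhds 0) :=
      (squeeze_zero (fun _ => norm_nonneg _) hxT tendsto_one_div_add_atTop_nhds_zero_nat).mono_left
        hU
    have h2 := ((h0.const_mul (2 * B)).add (h0.pow 2)).sub ((hlim (p - T p)).const_mul 2)
    have h3 : ‖p - T p‖ ^ 2 ≤ 2 * B * 0 + 0 ^ 2 - 2 * 0 := ge_of_tendsto' h2 h1
    have h4 : ‖p - T p‖ = 0 := by nlinarith [norm_nonneg (p - T p)]
    exact (sub_eq_zero.1 (norm_eq_zero.1 h4)).symm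
  have h1 : ε ≤ ⟪d, w⟫ := ge_of_tendsto' (hd w) fun n => by
    rw [real_inner_comm]; exact (hxw n).le
  have h2 := hw p hpQ hpT
  rw [hp, add_sub_cancel_right, real_inner_comm] at h2
  linarith

/-- A Xu-type lemma on real sequences satisfying a perturbed contractive recursion. -/
theorem eventually_le_of_recursion {s g a c : ℕ → ℝ} {M k : ℝ} (hk : 0 < k)
    (hc : ∀ n, 0 ≤ c n) (hcs : Summable c)
    (ha : Tendsto (fun n => ∑ i ∈ Finset.range n, a i) atTop atTop)
    (hg : ∀ᶠ n in atTop, 0 ≤ g n ∧ k * a n ≤ g n ∧ g n ≤ 1)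
    (hs : ∀ᶠ n in atTop, s (n + 1) ≤ (1 - g n) * s n + g n * M + c n)
    {δ : ℝ} (hδ : 0 < δ) : ∀ᶠ n in atTop, s n ≤ M + δ := by
  set A : ℕ → ℝ := fun n => ∑ i ∈ Finset.range n, a i with hA
  set D : ℕ → ℝ := fun n => ∑ i ∈ Finset.range n, c i with hD
  have hDlim : Tendsto D atTop (nhds (∑' i, c i)) := hcs.hasSum.tendsto_sum_nat
  have hDle : ∀ n, D n ≤ ∑' i, c i := fun n => hcs.sum_le_tsum _ fun i _ => hc i
  have hDmono : Monotone D := monotone_nat_of_le_succ fun n => by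
    simp only [hD, Finset.sum_range_succ]; linarith [hc n]
  have hDev : ∀ᶠ n in atTop, (∑' i, c i) - δ / 2 < D n :=
    hDlim.eventually (lt_mem_nhds (by linarith))
  obtain ⟨N, hN⟩ := eventually_atTop.1 (hg.and (hs.and hDev))
  set r : ℕ → ℝ := fun n => s n - M - (D n - D N) with hr
  have hbound : ∀ n, N ≤ n → r n ≤ Real.exp (-(k * (A n - A N))) * |r N| := by
    intro n hn
    induction n, hn using Nat.le_induction with
    | base => simpa using le_abs_self _
    | succ n hn ih =>
      obtain ⟨⟨hg0, hgk, hg1⟩, hsn, -⟩ := hN n hn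
      have h1 : r (n + 1) ≤ (1 - g n) * r n := by
        have h2 : D (n + 1) = D n + c n := by simp only [hD, Finset.sum_range_succ]
        simp only [hr, h2]
        nlinarith [mul_nonneg hg0 (sub_nonneg.2 (hDmono hn))]
      have h3 : A (n + 1) = A n + a n := by simp only [hA, Finset.sum_range_succ]
      have h4 : 1 - g n ≤ Real.exp (-(k * a n)) := by
        linarith [Real.add_one_le_exp (-(k * a n))]
      calc r (n + 1) ≤ (1 - g n) * r n := h1
        _ ≤ (1 - g n) * (Real.exp (-(k * (A n - A N))) * |r N|) :=
          mul_le_mul_of_nonneg_left ih (by linarith)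
        _ ≤ Real.exp (-(k * a n)) * (Real.exp (-(k * (A n - A N))) * |r N|) :=
          mul_le_mul_of_nonneg_right h4 (by positivity)
        _ = _ := by rw [← mul_assoc, ← Real.exp_add, h3]; congr 2; ring
  have hlim : Tendsto (fun n => Real.exp (-(k * (A n - A N))) * |r N|) atTop (nhds 0) := by
    have h1 : Tendsto (fun n => k * (A n - A N)) atTop atTop :=
      (tendsto_atTop_add_const_right atTop (-A N) ha).const_mul_atTop hk
    simpa using (Real.tendsto_exp_neg_atTop_nhds_zero.comp h1).mul_const |r N|
  filter_upwards [hlim.eventually (gt_mem_nhds (half_pos hδ)), eventually_ge_atTop N] with n h1 h2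
  have h3 := hbound n h2
  have h4 := (hN N le_rfl).2.2
  simp only [hr] at h3 h1
  linarith [hDle n]

/-- `I - a F` contracts for small `a` when `F` is Lipschitz and strongly monotone. -/
theorem norm_sub_smul_le {H : Type*} [NormedAddCommGroup H] [InnerProductSpace ℝ H]
    {d D : H} {a κ η τ : ℝ} (hD : ‖D‖ ≤ κ * ‖d‖) (hmono : η * ‖d‖ ^ 2 ≤ ⟪D, d⟫)
    (ha : 0 ≤ a) (haτ : a * τ ≤ 1) (haκ : a * κ ^ 2 ≤ 2 * (η - τ)) :
    ‖d - a • D‖ ≤ (1 - a * τ) * ‖d‖ := by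
  refine abs_le_of_sq_le_sq' ?_ (mul_nonneg (by linarith) (norm_nonneg _)) |>.2
  rw [norm_sub_sq_real, inner_smul_right, norm_smul, Real.norm_of_nonneg ha, real_inner_comm]
  have h1 : ‖D‖ ^ 2 ≤ (κ * ‖d‖) ^ 2 := by gcongr
  have h2 := mul_le_mul_of_nonneg_left h1 (sq_nonneg a)
  have h3 := mul_le_mul_of_nonneg_left hmono ha
  have h4 := mul_le_mul_of_nonneg_left haκ (mul_nonneg ha (sq_nonneg ‖d‖))
  nlinarith [sq_nonneg (a * τ * ‖d‖)]

/-- One projected step `y` of the perturbed algorithm, from `x`, relative to a fixed point `z`. -/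
theorem norm_sq_step_sub_le {H : Type*} [NormedAddCommGroup H] [InnerProductSpace ℝ H]
    {x t z y fx fz Ft Fz e : H} {a αf κ η τ : ℝ} (ha : 0 ≤ a)
    (ht : ‖t - z‖ ≤ ‖x - z‖) (hf : ‖fx - fz‖ ≤ αf * ‖x - z‖)
    (hF : ‖Ft - Fz‖ ≤ κ * ‖t - z‖) (hmono : η * ‖t - z‖ ^ 2 ≤ ⟪Ft - Fz, t - z⟫)
    (haτ : a * τ ≤ 1) (haκ : a * κ ^ 2 ≤ 2 * (η - τ))
    (hy : ⟪a • fx + (t - a • Ft) + e - y, z - y⟫ ≤ 0) :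
    ‖y - z‖ ^ 2 ≤ (1 - a * (τ - αf)) * ‖x - z‖ * ‖y - z‖ + a * ⟪fz - Fz, y - z⟫
      + ‖e‖ * ‖y - z‖ := by
  have h1 := norm_sq_proj_sub_le hy
  have h2 : a • fx + (t - a • Ft) + e - z
      = ((t - z) - a • (Ft - Fz)) + a • (fx - fz) + a • (fz - Fz) + e := by
    simp only [smul_sub]; abel
  rw [h2, inner_add_left, inner_add_left, inner_add_left, real_inner_smul_left,
    real_inner_smul_left] at h1
  have h3 := norm_sub_smul_le hF hmono ha haτ haκ
  have h4 : ‖(t - z) - a • (Ft - Fz)‖ ≤ (1 - a * τ) * ‖x - z‖ :=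
    h3.trans (mul_le_mul_of_nonneg_left ht (by linarith))
  have h5 := (real_inner_le_norm ((t - z) - a • (Ft - Fz)) (y - z)).trans
    (mul_le_mul_of_nonneg_right h4 (norm_nonneg _))
  have h6 := (real_inner_le_norm (fx - fz) (y - z)).trans
    (mul_le_mul_of_nonneg_right hf (norm_nonneg _))
  have h7 := mul_le_mul_of_nonneg_left h6 ha
  have h8 := real_inner_le_norm e (y - z)
  linarith

/-- The squared norm of a convex combination in a real inner product space. -/
theorem norm_sq_convex_comb {H : Type*} [NormedAddCommGroup H] [InnerProductSpace ℝ H]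
    (b : ℝ) (u v : H) :
    ‖b • u + (1 - b) • v‖ ^ 2 = b * ‖u‖ ^ 2 + (1 - b) * ‖v‖ ^ 2 - b * (1 - b) * ‖u - v‖ ^ 2 := by
  rw [norm_add_sq_real, norm_sub_sq_real, norm_smul, norm_smul, real_inner_smul_left,
    real_inner_smul_right, mul_pow, mul_pow, Real.norm_eq_abs, Real.norm_eq_abs, sq_abs, sq_abs]
  ring

/-- Theorem 2, case (h1): strong convergence of the perturbed algorithm (HPA) under the
condition `0 < liminf β_n ≤ limsup β_n < 1`. -/
theorem hpa_convergence_h1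
    {H : Type*} [NormedAddCommGroup H] [InnerProductSpace ℝ H] [CompleteSpace H]
    (Q : Set H) (hQne : Q.Nonempty) (hQclosed : IsClosed Q) (hQconvex : Convex ℝ Q)
    (T f F : H → H)
    (hTmaps : ∀ x ∈ Q, T x ∈ Q)
    (hTnonexp : ∀ x ∈ Q, ∀ y ∈ Q, ‖T x - T y‖ ≤ ‖x - y‖)
    (C : Set H) (hC : C = {x | x ∈ Q ∧ T x = x}) (hCne : C.Nonempty)
    (αf : ℝ) (hαf : 0 ≤ αf)
    (hfLip : ∀ x ∈ Q, ∀ y ∈ Q, ‖f x - f y‖ ≤ αf * ‖x - y‖)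
    (κ η : ℝ) (hκ : 0 < κ) (hη : 0 < η)
    (hFLip : ∀ x ∈ Q, ∀ y ∈ Q, ‖F x - F y‖ ≤ κ * ‖x - y‖)
    (hFmono : ∀ x ∈ Q, ∀ y ∈ Q, η * ‖x - y‖ ^ 2 ≤ ⟪F x - F y, x - y⟫)
    (hαη : αf < η)
    (PQ : H → H)
    (hPQ : ∀ x : H, PQ x ∈ Q ∧ ∀ y ∈ Q, ⟪x - PQ x, y - PQ x⟫ ≤ 0)
    (e : ℕ → H) (α β : ℕ → ℝ)
    (hα : ∀ n, α n ∈ Set.Ioc (0 : ℝ) 1)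
    (hβ : ∀ n, β n ∈ Set.Icc (0 : ℝ) 1)
    (hα0 : Tendsto α atTop (nhds 0))
    (hαsum : Tendsto (fun n => ∑ i ∈ Finset.range n, α i) atTop atTop)
    (hβliminf : 0 < liminf β atTop)
    (hβlimsup : limsup β atTop < 1)
    (he : (Summable fun n => ‖e n‖) ∨ Tendsto (fun n => ‖e n‖ / α n) atTop (nhds 0))
    (x : ℕ → H) (hx0 : x 0 ∈ Q)
    (hrec : ∀ n, x (n + 1) = β n • x n
      + (1 - β n) • PQ (α n • f (x n) + (T (x n) - α n • F (T (x n))) + e n))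
    (qstar : H) (hqstarC : qstar ∈ C)
    (hqstarVIP : ∀ p ∈ C, 0 ≤ ⟪F qstar - f qstar, p - qstar⟫) :
    Tendsto x atTop (nhds qstar) := by
  subst hC
  obtain ⟨hzQ, hzT⟩ := hqstarC
  set z := qstar
  set w := f z - F z with hw
  have hwC : ∀ p ∈ Q, T p = p → ⟪w, p - z⟫ ≤ 0 := fun p hp hTp => by
    have h := hqstarVIP p ⟨hp, hTp⟩
    rw [← neg_sub, inner_neg_left] at h
    linarith
  set τ := (αf + η) / 2 with hτ
  set σ := τ - αf with hσ
  have hσ0 : 0 < σ := by rw [hσ, hτ]; linarith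
  have hα1 : ∀ n, 0 < α n ∧ α n ≤ 1 := fun n => hα n
  have hβ1 : ∀ n, 0 ≤ β n ∧ β n ≤ 1 := fun n => hβ n
  obtain ⟨k, c, hk0, hc0, hcs, hek⟩ : ∃ k c : ℕ → ℝ, Tendsto k atTop (nhds 0) ∧
      (∀ n, 0 ≤ c n) ∧ Summable c ∧ ∀ n, ‖e n‖ ≤ α n * k n + c n := by
    rcases he with he | he
    · exact ⟨0, fun n => ‖e n‖, tendsto_const_nhds, fun n => norm_nonneg _, he, by simp⟩
    · refine ⟨_, 0, he, by simp, summable_zero, fun n => ?_⟩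
      simp [mul_div_cancel₀ _ (hα1 n).1.ne']
  have he0 : Tendsto (fun n => ‖e n‖) atTop (nhds 0) := by
    have h := (hα0.mul hk0).add hcs.tendsto_atTop_zero
    rw [mul_zero, add_zero] at h
    exact squeeze_zero (fun _ => norm_nonneg _) hek h
  obtain ⟨b, hb0, hb⟩ : ∃ b > 0, ∀ᶠ n in atTop, b ≤ β n ∧ b ≤ 1 - β n := by
    obtain ⟨b₁, hb₁, hb₁'⟩ := exists_between hβliminf
    obtain ⟨b₂, hb₂, hb₂'⟩ := exists_between hβlimsup
    refine ⟨min b₁ (1 - b₂), lt_min hb₁ (by linarith), ?_⟩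
    have h1 : IsBoundedUnder (· ≥ ·) atTop β := isBoundedUnder_of ⟨0, fun n => (hβ1 n).1⟩
    have h2 : IsBoundedUnder (· ≤ ·) atTop β := isBoundedUnder_of ⟨1, fun n => (hβ1 n).2⟩
    filter_upwards [eventually_lt_of_lt_liminf hb₁' h1, eventually_lt_of_limsup_lt hb₂ h2]
      with n h3 h4
    exact ⟨(min_le_left _ _).trans h3.le, (min_le_right _ _).trans (by linarith)⟩
  set u : ℕ → H := fun n => α n • f (x n) + (T (x n) - α n • F (T (x n))) + e n with hu
  set y : ℕ → H := fun n => PQ (u n) with hydef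
  have hyQ : ∀ n, y n ∈ Q := fun n => (hPQ _).1
  have hrec' : ∀ n, x (n + 1) = β n • x n + (1 - β n) • y n := hrec
  have hxQ : ∀ n, x n ∈ Q := by
    intro n
    induction n with
    | zero => exact hx0
    | succ n ih =>
      rw [hrec']
      exact hQconvex ih (hyQ n) (hβ1 n).1 (by linarith [(hβ1 n).2]) (by ring)
  have hTxQ : ∀ n, T (x n) ∈ Q := fun n => hTmaps _ (hxQ n)
  have hTz : ∀ n, ‖T (x n) - z‖ ≤ ‖x n - z‖ := fun n => by
    have h := hTnonexp _ (hxQ n) _ hzQ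
    rwa [hzT] at h
  have hsub : ∀ n, x (n + 1) - z = β n • (x n - z) + (1 - β n) • (y n - z) := fun n => by
    rw [hrec']; module
  have small : ∀ A B : ℝ, 0 < B → ∀ᶠ n in atTop, α n * A ≤ B := fun A B hB => by
    have h := hα0.mul_const A
    rw [zero_mul] at h
    exact (h.eventually (gt_mem_nhds hB)).mono fun n hn => hn.le
  have hασ : ∀ᶠ n in atTop, α n * σ ≤ 1 := small _ _ one_pos
  set g : ℕ → ℝ := fun n => (1 - β n) * (α n * σ) with hgdef
  have hg : ∀ᶠ n in atTop, 0 ≤ g n ∧ (b * σ) * α n ≤ g n ∧ g n ≤ 1 := by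
    filter_upwards [hασ, hb] with n h1 h2
    have h3 : 0 ≤ α n * σ := mul_nonneg (hα1 n).1.le hσ0.le
    have h4 : 0 ≤ 1 - β n := by linarith [(hβ1 n).2]
    refine ⟨mul_nonneg h4 h3, ?_, mul_le_one₀ (by linarith [(hβ1 n).1]) h3 h1⟩
    have := mul_le_mul_of_nonneg_right h2.2 h3
    simp only [hgdef]
    linarith
  have hstep : ∀ᶠ n in atTop, ‖y n - z‖ ^ 2 ≤ (1 - α n * σ) * ‖x n - z‖ * ‖y n - z‖
      + α n * ⟪w, y n - z⟫ + ‖e n‖ * ‖y n - z‖ := by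
    filter_upwards [small τ 1 one_pos, small (κ ^ 2) (2 * (η - τ)) (by rw [hτ]; linarith)]
      with n h1 h2
    refine norm_sq_step_sub_le (hα1 n).1.le (hTz n) (hfLip _ (hxQ n) _ hzQ)
      (hFLip _ (hTxQ n) _ hzQ) (hFmono _ (hTxQ n) _ hzQ) h1 h2 ((hPQ (u n)).2 z hzQ)
  have hY : ∀ᶠ n in atTop, ‖y n - z‖ ≤ (1 - α n * σ) * ‖x n - z‖ + α n * ‖w‖ + ‖e n‖ := by
    filter_upwards [hstep, hασ] with n h1 h2
    have hα := (hα1 n).1.le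
    have h3 := mul_le_mul_of_nonneg_left (real_inner_le_norm w (y n - z)) hα
    have h4 : 0 ≤ (1 - α n * σ) * ‖x n - z‖ + α n * ‖w‖ + ‖e n‖ := by
      have : 0 ≤ 1 - α n * σ := by linarith
      positivity
    rcases (norm_nonneg (y n - z)).eq_or_lt with h5 | h5
    · rwa [← h5]
    · refine le_of_mul_le_mul_right ?_ h5
      linarith
  obtain ⟨R, hR0, hR⟩ : ∃ R, 0 ≤ R ∧ ∀ᶠ n in atTop, ‖x n - z‖ ≤ R := by
    refine ⟨(‖w‖ + 1) / σ + 1, by positivity, eventually_le_of_recursion (mul_pos hb0 hσ0)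
      hc0 hcs hαsum hg ?_ one_pos⟩
    filter_upwards [hY, hk0.eventually (gt_mem_nhds one_pos)] with n h1 h2
    obtain ⟨hβ0, hβ1'⟩ := hβ1 n
    have h3 : ‖x (n + 1) - z‖ ≤ β n * ‖x n - z‖ + (1 - β n) * ‖y n - z‖ := by
      rw [hsub]
      refine (norm_add_le _ _).trans_eq ?_
      rw [norm_smul, norm_smul, Real.norm_of_nonneg hβ0, Real.norm_of_nonneg (by linarith)]
    have h4 : g n * ((‖w‖ + 1) / σ) = (1 - β n) * (α n * (‖w‖ + 1)) := by
      simp only [hgdef]; field_simp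
    have h5 : ‖y n - z‖ ≤ (1 - α n * σ) * ‖x n - z‖ + α n * (‖w‖ + 1) + c n := by
      have := mul_le_mul_of_nonneg_left h2.le (hα1 n).1.le
      linarith [hek n]
    have h6 := mul_le_mul_of_nonneg_left h5 (sub_nonneg.2 hβ1')
    have h7 := mul_nonneg hβ0 (hc0 n)
    rw [h4]
    simp only [hgdef]
    linarith
  set S := R + ‖w‖ + 1 with hS
  have hS0 : 0 ≤ S := by positivity
  have hYS : ∀ᶠ n in atTop, ‖y n - z‖ ≤ S := by
    filter_upwards [hY, hR, he0.eventually (gt_mem_nhds one_pos)] with n h1 h2 h3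
    have h4 := mul_nonneg (mul_nonneg (hα1 n).1.le hσ0.le) (norm_nonneg (x n - z))
    have h5 := mul_le_mul_of_nonneg_right (hα1 n).2 (norm_nonneg w)
    linarith
  have hyT : Tendsto (fun n => ‖y n - T (x n)‖) atTop (nhds 0) := by
    have h0 := (hα0.mul_const (αf * R + κ * R + ‖w‖)).add he0
    rw [zero_mul, add_zero] at h0
    refine squeeze_zero' (Eventually.of_forall fun _ => norm_nonneg _) ?_ h0
    filter_upwards [hR] with n hn
    have h1 : ‖y n - T (x n)‖ ≤ ‖u n - T (x n)‖ := by
      have h2 := (norm_sq_proj_sub_le ((hPQ (u n)).2 _ (hTxQ n))).trans (real_inner_le_norm _ _)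
      rw [sq] at h2
      rcases (norm_nonneg (y n - T (x n))).eq_or_lt with h3 | h3
      · rw [← h3]; positivity
      · exact le_of_mul_le_mul_right h2 h3
    have h2 : u n - T (x n)
        = α n • ((f (x n) - f z) - (F (T (x n)) - F z) + w) + e n := by
      simp only [hu, hw]; module
    have h3 : ‖(f (x n) - f z) - (F (T (x n)) - F z) + w‖ ≤ αf * R + κ * R + ‖w‖ := by
      have h4 := (hfLip _ (hxQ n) _ hzQ).trans (mul_le_mul_of_nonneg_left hn hαf)
      have h5 := (hFLip _ (hTxQ n) _ hzQ).trans
        (mul_le_mul_of_nonneg_left ((hTz n).trans hn) hκ.le)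
      exact (norm_add_le _ _).trans (by linarith [norm_sub_le (f (x n) - f z) (F (T (x n)) - F z)])
    refine h1.trans ?_
    rw [h2]
    refine (norm_add_le _ _).trans ?_
    rw [norm_smul, Real.norm_of_nonneg (hα1 n).1.le]
    linarith [mul_le_mul_of_nonneg_left h3 (hα1 n).1.le]
  have hinner : ∀ ε > 0, ∃ θ > 0, ∀ᶠ n in atTop, ‖x n - y n‖ ≤ θ → ⟪w, y n - z⟫ ≤ ε := by
    intro ε hε
    obtain ⟨θ, hθ, h⟩ := exists_inner_le_of_approx_fixed hTnonexp hPQ hwC R (half_pos hε)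
    refine ⟨min (θ / 2) (ε / 2 / (‖w‖ + 1)), by positivity, ?_⟩
    filter_upwards [hR, hyT.eventually (gt_mem_nhds (half_pos hθ))] with n h1 h2 h3
    have h4 : ‖x n - T (x n)‖ ≤ θ := by
      have := norm_sub_le_norm_sub_add_norm_sub (x n) (y n) (T (x n))
      linarith [h3.trans (min_le_left _ _)]
    have h5 := h _ (hxQ n) h1 h4
    have h6 : ⟪w, y n - x n⟫ ≤ ε / 2 := by
      have h7 := h3.trans (min_le_right _ _)
      rw [le_div_iff₀ (by positivity), norm_sub_rev] at h7
      linarith [real_inner_le_norm w (y n - x n), norm_nonneg (y n - x n)]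
    have h7 : y n - z = (x n - z) + (y n - x n) := by abel
    rw [h7, inner_add_right]
    linarith
  have hsq : ∀ ε > 0, ∀ᶠ n in atTop, ‖x n - z‖ ^ 2 ≤ ε + ε := by
    intro ε hε
    refine eventually_le_of_recursion (c := fun n => 2 * S * c n) (mul_pos hb0 hσ0)
      (fun n => mul_nonneg (by positivity) (hc0 n)) (hcs.mul_left _) hαsum hg ?_ hε
    obtain ⟨θ, hθ, hθ'⟩ := hinner (σ * ε / 4) (by positivity)
    have hkS : ∀ᶠ n in atTop, S * k n < σ * ε / 4 := by
      have h := hk0.const_mul S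
      rw [mul_zero] at h
      exact h.eventually (gt_mem_nhds (by positivity))
    filter_upwards [hstep, hασ, hYS, hθ', hkS, hb,
      small (2 * (‖w‖ * S + σ * ε / 4)) (b * θ ^ 2) (by positivity)] with n h1 h2 h3 h4 h5 h6 h7
    obtain ⟨hα0', -⟩ := hα1 n
    set X := ‖x n - z‖
    set Y := ‖y n - z‖
    set W := ⟪w, y n - z⟫
    have hY0 : 0 ≤ Y := norm_nonneg _
    have hYsq : Y ^ 2 ≤ (1 - α n * σ) * X ^ 2 + 2 * (α n * (W + S * k n)) + 2 * S * c n := by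
      have h8 : ‖e n‖ * Y ≤ (α n * k n + c n) * S :=
        mul_le_mul (hek n) h3 hY0 ((norm_nonneg _).trans (hek n))
      have h9 := mul_nonneg (mul_nonneg hα0'.le hσ0.le)
        (mul_nonneg (sub_nonneg.2 h2) (sq_nonneg X))
      nlinarith [sq_nonneg ((1 - α n * σ) * X - Y)]
    have hmain : 2 * (α n * (W + S * k n)) ≤ α n * σ * ε + b * ‖x n - y n‖ ^ 2 := by
      rcases le_total ‖x n - y n‖ θ with h8 | h8
      · have h9 : α n * (W + S * k n) ≤ α n * (σ * ε / 2) :=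
          mul_le_mul_of_nonneg_left (by linarith [h4 h8]) hα0'.le
        have : 0 ≤ b * ‖x n - y n‖ ^ 2 := by positivity
        linarith
      · have h9 : W ≤ ‖w‖ * S := (real_inner_le_norm _ _).trans
          (mul_le_mul_of_nonneg_left h3 (norm_nonneg _))
        have h10 : α n * (W + S * k n) ≤ α n * (‖w‖ * S + σ * ε / 4) :=
          mul_le_mul_of_nonneg_left (by linarith) hα0'.le
        have h11 : b * θ ^ 2 ≤ b * ‖x n - y n‖ ^ 2 := by gcongr
        have : 0 ≤ α n * σ * ε := by positivity
        linarith
    have hid := norm_sq_convex_comb (β n) (x n - z) (y n - z)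
    rw [← hsub, sub_sub_sub_cancel_right] at hid
    have hβ' : 0 ≤ 1 - β n := by linarith
    have h8 := mul_le_mul_of_nonneg_left (hYsq.trans
      (by linarith : _ ≤ (1 - α n * σ) * X ^ 2 + (α n * σ * ε + b * ‖x n - y n‖ ^ 2)
        + 2 * S * c n)) hβ'
    have h9 := mul_nonneg (mul_nonneg hβ' (sub_nonneg.2 h6.1)) (sq_nonneg ‖x n - y n‖)
    have h10 := mul_nonneg (hβ1 n).1 (mul_nonneg (mul_nonneg zero_le_two hS0) (hc0 n))
    rw [hid]
    simp only [hgdef]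
    linarith
  rw [tendsto_iff_norm_sub_tendsto_zero, Metric.tendsto_atTop']
  intro ε hε
  obtain ⟨N, hN⟩ := eventually_atTop.1 (hsq (ε ^ 2 / 4) (by positivity))
  refine ⟨N, fun n hn => ?_⟩
  rw [Real.dist_eq, sub_zero, abs_norm]
  refine lt_of_pow_lt_pow_left₀ 2 hε.le ?_
  have := sq_pos_of_pos hε
  linarith [hN n hn.le]
end

section
/- (Theorem of Section 5, first part.) Assume the limit case α = η, i.e. f : Q → H is Lipschitz with constant η. Let ε > 0. Let {e_n} ⊆ H, {α_n} ⊆ (0,1] and {β_n} ⊆ [0,1] satisfy: α_n → 0, ∑ α_n = +∞; either 0 < liminf β_n ≤ limsup β_n < 1, or (limsup β_n < 1, either (β_{n+1} − β_n)/α_n → 0 or ∑ |β_{n+1} − β_n| < +∞, and either (α_{n+1} − α_n)/α_n → 0 or ∑ |α_{n+1} − α_n| < +∞); and ∑ ‖e_n‖ < +∞ or ‖e_n‖/α_n → 0. Then for every x_0 ∈ Q, the sequence defined by x_{n+1} = β_n x_n + (1 − β_n) P_Q(α_n f(x_n) + (1 − α_n ε) T x_n − α_n F(T x_n) + e_n)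 converges strongly to the unique point q^ε of C = Fix(T) satisfying ⟨F(q^ε) + ε q^ε − f(q^ε), x − q^ε⟩ ≥ 0 for all x ∈ C. -/
open scoped RealInnerProductSpace
open Filter

/-- `w` is asymptotically dominated by `α` up to a summable sequence. -/
def IsNegligible (α w : ℕ → ℝ) : Prop :=
  ∃ c : ℕ → ℝ, (∀ n, 0 ≤ c n) ∧ Summable c ∧ ∀ δ > 0, ∀ᶠ n in atTop, w n ≤ δ * α n + c n

namespace IsNegligible

variable {α v w : ℕ → ℝ}

theorem of_div_or_summable (hα : ∀ n, 0 < α n)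
    (h : Tendsto (fun n => w n / α n) atTop (nhds 0) ∨ Summable fun n => |w n|) :
    IsNegligible α (fun n => |w n|) := by
  rcases h with h | h
  · refine ⟨fun _ => 0, fun _ => le_rfl, summable_zero, fun δ hδ => ?_⟩
    filter_upwards [(tendsto_zero_iff_abs_tendsto_zero _).1 h |>.eventually_le_const hδ] with n hn
    simp only [Function.comp, abs_div, abs_of_pos (hα n)] at hn
    rw [div_le_iff₀ (hα n)] at hn
    simpa using hn
  · refine ⟨fun n => |w n|, fun _ => abs_nonneg _, h, fun δ hδ => Eventually.of_forall fun n => ?_⟩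
    have := mul_pos hδ (hα n)
    linarith

theorem add (hv : IsNegligible α v) (hw : IsNegligible α w) :
    IsNegligible α (fun n => v n + w n) := by
  obtain ⟨c, hc0, hc, h⟩ := hv
  obtain ⟨d, hd0, hd, h'⟩ := hw
  refine ⟨fun n => c n + d n, fun n => add_nonneg (hc0 n) (hd0 n), hc.add hd, fun δ hδ => ?_⟩
  filter_upwards [h _ (half_pos hδ), h' _ (half_pos hδ)] with n h1 h2
  linarith

theorem const_mul {K : ℝ} (hK : 0 < K) (hw : IsNegligible α w) :
    IsNegligible α (fun n => K * w n) := by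
  obtain ⟨c, hc0, hc, h⟩ := hw
  refine ⟨fun n => K * c n, fun n => mul_nonneg hK.le (hc0 n), hc.mul_left K, fun δ hδ => ?_⟩
  filter_upwards [h _ (div_pos hδ hK)] with n h1
  calc K * w n ≤ K * (δ / K * α n + c n) := by gcongr
    _ = δ * α n + K * c n := by field_simp

end IsNegligible

theorem eventually_le_of_succ_le_one_sub_mul {γ t : ℕ → ℝ} (hγ : ∀ᶠ n in atTop, γ n ≤ 1)
    (hsum : Tendsto (fun n => ∑ i ∈ Finset.range n, γ i) atTop atTop)
    (ht : ∀ᶠ n in atTop, t (n + 1) ≤ (1 - γ n) * t n) {δ : ℝ} (hδ : 0 < δ) :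
    ∀ᶠ n in atTop, t n ≤ δ := by
  obtain ⟨N, hN⟩ := eventually_atTop.1 (hγ.and ht)
  set S : ℕ → ℝ := fun n => ∑ i ∈ Finset.range n, γ i with hS
  have key : ∀ n ≥ N, t n ≤ |t N| * Real.exp (S N - S n) := by
    intro n hn
    induction n, hn using Nat.le_induction with
    | base => simpa using le_abs_self (t N)
    | succ n hn ih =>
      obtain ⟨h1, h2⟩ := hN n hn
      have h3 : 1 - γ n ≤ Real.exp (-γ n) := by
        have := Real.add_one_le_exp (-γ n)
        linarith
      calc t (n + 1) ≤ (1 - γ n) * t n := h2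
        _ ≤ (1 - γ n) * (|t N| * Real.exp (S N - S n)) :=
          mul_le_mul_of_nonneg_left ih (by linarith)
        _ ≤ Real.exp (-γ n) * (|t N| * Real.exp (S N - S n)) := by gcongr
        _ = |t N| * Real.exp (S N - S (n + 1)) := by
          have : S N - S (n + 1) = -γ n + (S N - S n) := by
            simp only [hS, Finset.sum_range_succ]
            ring
          rw [this, Real.exp_add]
          ring
  have hlim : Tendsto (fun n => |t N| * Real.exp (S N - S n)) atTop (nhds 0) := by
    have h1 : Tendsto (fun n => S N - S n) atTop atBot :=
      tendsto_atBot_add_const_left _ (S N) (tendsto_neg_atTop_atBot.comp hsum)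
    simpa using (Real.tendsto_exp_atBot.comp h1).const_mul |t N|
  filter_upwards [hlim.eventually_le_const hδ, eventually_ge_atTop N] with n h1 h2
  exact (key n h2).trans h1

theorem tendsto_zero_of_succ_le_of_isNegligible {α a w : ℕ → ℝ} {k : ℝ} (hk : 0 < k)
    (hα : ∀ n, 0 < α n) (hα0 : Tendsto α atTop (nhds 0))
    (hαsum : Tendsto (fun n => ∑ i ∈ Finset.range n, α i) atTop atTop)
    (ha : ∀ n, 0 ≤ a n) (hw : IsNegligible α w)
    (hrec : ∀ᶠ n in atTop, a (n + 1) ≤ (1 - k * α n) * a n + w n) :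
    Tendsto a atTop (nhds 0) := by
  obtain ⟨c, hc0, hc, hwc⟩ := hw
  have hkα : ∀ᶠ n in atTop, k * α n ≤ 1 := by
    have : Tendsto (fun n => k * α n) atTop (nhds 0) := by simpa using hα0.const_mul k
    exact this.eventually_le_const one_pos
  have hksum : Tendsto (fun n => ∑ i ∈ Finset.range n, k * α i) atTop atTop := by
    simp only [← Finset.mul_sum]
    exact hαsum.const_mul_atTop hk
  set r : ℕ → ℝ := fun n => ∑' i, c (i + n) with hr
  have hr0 : Tendsto r atTop (nhds 0) := tendsto_sum_nat_add c
  have hrnn : ∀ n, 0 ≤ r n := fun n => tsum_nonneg fun i => hc0 _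
  have hrs : ∀ n, r n = c n + r (n + 1) := by
    intro n
    have := ((summable_nat_add_iff n).2 hc).tsum_eq_zero_add
    simp only [hr, this, zero_add]
    congr 2
    ext i
    congr 1
    ring
  rw [Metric.tendsto_atTop']
  intro δ hδ
  suffices h : ∀ᶠ n in atTop, a n < δ by
    obtain ⟨N, hN⟩ := eventually_atTop.1 h
    refine ⟨N, fun n hn => ?_⟩
    rw [Real.dist_0_eq_abs, abs_of_nonneg (ha n)]
    exact hN n hn.le
  have hδ4 : 0 < δ / 4 := by linarith
  have ht := eventually_le_of_succ_le_one_sub_mul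
    (t := fun n => a n + r n - δ / 2) hkα hksum ?_ hδ4
  · filter_upwards [ht] with n hn
    have := hrnn n
    linarith
  · filter_upwards [hrec, hwc _ (mul_pos hk hδ4), hr0.eventually_le_const hδ4] with n h1 h2 h3
    have h4 : k * α n * r n ≤ k * α n * (δ / 4) :=
      mul_le_mul_of_nonneg_left h3 (mul_pos hk (hα n)).le
    have h5 := hrs n
    nlinarith

section Hilbert

variable {H : Type*} [NormedAddCommGroup H] [InnerProductSpace ℝ H]

theorem exists_weak_limit [CompleteSpace H] (U : Ultrafilter ℕ) {z : ℕ → H} {R : ℝ}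
    (hz : ∀ n, ‖z n‖ ≤ R) :
    ∃ p : H, ∀ h : H, Tendsto (fun n => ⟪z n, h⟫) U (nhds ⟪p, h⟫) := by
  have hK := WeakDual.isCompact_closedBall (𝕜 := ℝ) (E := H) 0 R
  let φ : ℕ → WeakDual ℝ H := fun n => StrongDual.toWeakDual (InnerProductSpace.toDual ℝ H (z n))
  obtain ⟨ψ, -, hψ⟩ := hK.ultrafilter_le_nhds (U.map φ) (by
    rw [le_principal_iff]
    refine Ultrafilter.mem_map.2 (univ_mem' fun n => ?_)
    simpa [φ] using hz n)
  refine ⟨(InnerProductSpace.toDual ℝ H).symm (WeakDual.toStrongDual ψ), fun h => ?_⟩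
  have h1 : Tendsto φ U (nhds ψ) := hψ
  have h2 := ((WeakDual.eval_continuous h).tendsto ψ).comp h1
  rw [InnerProductSpace.toDual_symm_apply]
  exact h2

theorem norm_sub_le_of_proj {Q : Set H} {PQ : H → H}
    (hPQ : ∀ x : H, PQ x ∈ Q ∧ ∀ y ∈ Q, ⟪x - PQ x, y - PQ x⟫ ≤ 0) (x y : H) :
    ‖PQ x - PQ y‖ ≤ ‖x - y‖ := by
  have h1 := (hPQ x).2 _ (hPQ y).1
  have h2 := (hPQ y).2 _ (hPQ x).1
  have h3 : ‖PQ x - PQ y‖ ^ 2 ≤ ⟪x - y, PQ x - PQ y⟫ := by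
    have e1 : ⟪x - PQ x, PQ y - PQ x⟫ = -⟪x - PQ x, PQ x - PQ y⟫ := by
      rw [← inner_neg_right, neg_sub]
    have e2 : x - y = (x - PQ x) - (y - PQ y) + (PQ x - PQ y) := by abel
    rw [e2, inner_add_left, inner_sub_left, real_inner_self_eq_norm_sq]
    linarith
  have h4 := real_inner_le_norm (x - y) (PQ x - PQ y)
  by_contra! h
  nlinarith [norm_nonneg (x - y), norm_nonneg (PQ x - PQ y)]

/-- A uniform form of the demiclosedness principle for nonexpansive maps. -/
theorem exists_inner_le_of_norm_sub_le [CompleteSpace H] {Q : Set H} {T PQ : H → H}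
    (hTnonexp : ∀ x ∈ Q, ∀ y ∈ Q, ‖T x - T y‖ ≤ ‖x - y‖)
    (hPQ : ∀ x : H, PQ x ∈ Q ∧ ∀ y ∈ Q, ⟪x - PQ x, y - PQ x⟫ ≤ 0)
    {D q : H} (hD : ∀ p ∈ Q, T p = p → ⟪D, p - q⟫ ≤ 0) (R : ℝ) {δ : ℝ} (hδ : 0 < δ) :
    ∃ τ > 0, ∀ z ∈ Q, ‖z - q‖ ≤ R → ‖z - T z‖ ≤ τ → ⟪D, z - q⟫ ≤ δ := by
  by_contra! hcon
  choose z hzQ hzR hzT hzD using fun n : ℕ => hcon (1 / ((n : ℝ) + 1)) (by positivity)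
  let U : Ultrafilter ℕ := hyperfilter ℕ
  have hU : (U : Filter ℕ) ≤ atTop := Nat.hyperfilter_le_atTop
  obtain ⟨p, hp⟩ := exists_weak_limit U (z := z) (R := R + ‖q‖) fun n => by
    calc ‖z n‖ = ‖(z n - q) + q‖ := by rw [sub_add_cancel]
      _ ≤ ‖z n - q‖ + ‖q‖ := norm_add_le _ _
      _ ≤ R + ‖q‖ := by gcongr; exact hzR n
  have hp' : ∀ a h : H, Tendsto (fun n => ⟪h, z n - a⟫) U (nhds ⟪h, p - a⟫) := by
    intro a h
    simp only [inner_sub_right]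
    simpa only [real_inner_comm] using (hp h).sub_const ⟪h, a⟫
  have hpQ : p ∈ Q := by
    have h1 : ⟪p - PQ p, p - PQ p⟫ ≤ 0 :=
      le_of_tendsto (hp' (PQ p) (p - PQ p)) (Eventually.of_forall fun n => (hPQ p).2 _ (hzQ n))
    have h2 := real_inner_self_nonpos.1 h1
    rw [sub_eq_zero.1 h2]
    exact (hPQ p).1
  have hpT : T p = p := by
    have hz0 : Tendsto (fun n => ‖z n - T (z n)‖) U (nhds 0) :=
      (squeeze_zero (fun n => norm_nonneg _) hzT tendsto_one_div_add_atTop_nhds_zero_nat).mono_left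
        hU
    have hlim : Tendsto (fun n => 2 * (R + ‖q - p‖) * ‖z n - T (z n)‖ + ‖z n - T (z n)‖ ^ 2
        - 2 * ⟪p - T p, z n - p⟫) U (nhds 0) := by
      simpa using ((hz0.const_mul (2 * (R + ‖q - p‖))).add (hz0.pow 2)).sub
        ((hp' p (p - T p)).const_mul 2)
    have hle : ‖p - T p‖ ^ 2 ≤ 0 := ge_of_tendsto hlim (Eventually.of_forall fun n => by
      have h1 : ‖z n - T p‖ ≤ ‖z n - T (z n)‖ + ‖z n - p‖ :=
        (norm_sub_le_norm_sub_add_norm_sub _ (T (z n)) _).trans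
          (by gcongr; exact hTnonexp _ (hzQ n) _ hpQ)
      have h2 : ‖z n - T p‖ ^ 2
          = ‖z n - p‖ ^ 2 + 2 * ⟪p - T p, z n - p⟫ + ‖p - T p‖ ^ 2 := by
        rw [← sub_add_sub_cancel (z n) p (T p), norm_add_sq_real, real_inner_comm]
      have h3 : ‖z n - p‖ ≤ R + ‖q - p‖ :=
        (norm_sub_le_norm_sub_add_norm_sub _ q _).trans (by gcongr; exact hzR n)
      have h4 : ‖z n - T p‖ ^ 2 ≤ (‖z n - T (z n)‖ + ‖z n - p‖) ^ 2 := by gcongr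
      nlinarith [norm_nonneg (z n - T (z n))])
    have h5 : ‖p - T p‖ = 0 := by nlinarith [norm_nonneg (p - T p)]
    exact (sub_eq_zero.1 (norm_eq_zero.1 h5)).symm
  have h6 : δ ≤ ⟪D, p - q⟫ :=
    ge_of_tendsto (hp' q D) (Eventually.of_forall fun n => (hzD n).le)
  linarith [hD p hpQ hpT]

theorem norm_regularized_step_sub_le {Q : Set H} {T f F : H → H} {κ η ε a : ℝ}
    (hTmaps : ∀ x ∈ Q, T x ∈ Q)
    (hTnonexp : ∀ x ∈ Q, ∀ y ∈ Q, ‖T x - T y‖ ≤ ‖x - y‖)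
    (hη : 0 < η) (hε : 0 < ε)
    (hfLip : ∀ x ∈ Q, ∀ y ∈ Q, ‖f x - f y‖ ≤ η * ‖x - y‖)
    (hFLip : ∀ x ∈ Q, ∀ y ∈ Q, ‖F x - F y‖ ≤ κ * ‖x - y‖)
    (hFmono : ∀ x ∈ Q, ∀ y ∈ Q, η * ‖x - y‖ ^ 2 ≤ ⟪F x - F y, x - y⟫)
    (ha : 0 ≤ a) (ha1 : a * (ε ^ 2 + 2 * ε * η + κ ^ 2) ≤ ε) (ha2 : a * (η + ε) ≤ 1)
    {x y : H} (hx : x ∈ Q) (hy : y ∈ Q) :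
    ‖(T x + a • (f x - ε • T x - F (T x))) - (T y + a • (f y - ε • T y - F (T y)))‖
      ≤ (1 - ε / 2 * a) * ‖x - y‖ := by
  have hu := hTmaps x hx
  have hv := hTmaps y hy
  have hFm := hFmono _ hu _ hv
  have hFl := hFLip _ hu _ hv
  have hT := hTnonexp _ hx _ hy
  set u := T x
  set v := T y
  have hkey : ‖(1 - a * ε) • (u - v) - a • (F u - F v)‖ ≤ (1 - a * (η + ε / 2)) * ‖u - v‖ := by
    have hc : 0 ≤ 1 - a * (η + ε / 2) := by nlinarith [mul_nonneg ha hε.le]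
    refine abs_le_of_sq_le_sq' ?_ (mul_nonneg hc (norm_nonneg _)) |>.2
    have hac : 0 ≤ 1 - a * ε := by nlinarith [mul_nonneg ha hη.le]
    rw [norm_sub_sq_real, inner_smul_left, inner_smul_right, norm_smul, norm_smul,
      Real.norm_of_nonneg hac, Real.norm_of_nonneg ha, real_inner_comm]
    simp only [conj_trivial]
    have h1 : (1 - a * ε) * a * (η * ‖u - v‖ ^ 2) ≤ (1 - a * ε) * a * ⟪F u - F v, u - v⟫ :=
      mul_le_mul_of_nonneg_left hFm (mul_nonneg hac ha)
    have h2 : a ^ 2 * ‖F u - F v‖ ^ 2 ≤ a ^ 2 * (κ * ‖u - v‖) ^ 2 := by gcongr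
    have h3 : a * (a * (ε ^ 2 + 2 * ε * η + κ ^ 2)) * ‖u - v‖ ^ 2 ≤ a * ε * ‖u - v‖ ^ 2 := by
      gcongr
    have h4 : 0 ≤ (a * (η + ε / 2)) ^ 2 * ‖u - v‖ ^ 2 := by positivity
    nlinarith
  have hdecomp : (u + a • (f x - ε • u - F u)) - (v + a • (f y - ε • v - F v))
      = a • (f x - f y) + ((1 - a * ε) • (u - v) - a • (F u - F v)) := by
    module
  rw [hdecomp]
  calc _ ≤ ‖a • (f x - f y)‖ + ‖(1 - a * ε) • (u - v) - a • (F u - F v)‖ := norm_add_le _ _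
    _ ≤ a * (η * ‖x - y‖) + (1 - a * (η + ε / 2)) * ‖x - y‖ := by
      rw [norm_smul, Real.norm_of_nonneg ha]
      have hc : 0 ≤ 1 - a * (η + ε / 2) := by nlinarith [mul_nonneg ha hε.le]
      have := hfLip _ hx _ hy
      have := hkey.trans (mul_le_mul_of_nonneg_left hT hc)
      gcongr
    _ = (1 - ε / 2 * a) * ‖x - y‖ := by ring

/-- One step of the relaxed projected iteration `z ↦ b z + (1 - b) P(T z + a G z)`. -/
def hpaStep (PQ T G : H → H) (a b : ℝ) (z : H) : H :=
  b • z + (1 - b) • PQ (T z + a • G z)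

/-- The data of an error-free hybrid projection scheme, where `q` solves the variational
inequality for `-G` on the fixed points of `T` and the unprojected steps are contractive. -/
structure IsHpaScheme (Q : Set H) (PQ T G : H → H) (q : H) (k b L : ℝ) (α β : ℕ → ℝ) :
    Prop where
  convex : Convex ℝ Q
  mapsTo : ∀ x ∈ Q, T x ∈ Q
  nonexp : ∀ x ∈ Q, ∀ y ∈ Q, ‖T x - T y‖ ≤ ‖x - y‖
  proj : ∀ x : H, PQ x ∈ Q ∧ ∀ y ∈ Q, ⟪x - PQ x, y - PQ x⟫ ≤ 0
  lip_nonneg : 0 ≤ L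
  lip : ∀ x ∈ Q, ∀ y ∈ Q, ‖G x - G y‖ ≤ L * ‖x - y‖
  q_mem : q ∈ Q
  q_fixed : T q = q
  vip : ∀ p ∈ Q, T p = p → ⟪G q, p - q⟫ ≤ 0
  k_pos : 0 < k
  b_pos : 0 < b
  alpha_mem : ∀ n, α n ∈ Set.Ioc (0 : ℝ) 1
  alpha_tendsto : Tendsto α atTop (nhds 0)
  alpha_sum : Tendsto (fun n => ∑ i ∈ Finset.range n, α i) atTop atTop
  beta_mem : ∀ n, β n ∈ Set.Icc (0 : ℝ) 1
  beta_le : ∀ᶠ n in atTop, β n ≤ 1 - b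
  contr : ∀ᶠ n in atTop, ∀ x ∈ Q, ∀ y ∈ Q,
    ‖(T x + α n • G x) - (T y + α n • G y)‖ ≤ (1 - k * α n) * ‖x - y‖

namespace IsHpaScheme

variable {Q : Set H} {PQ T G : H → H} {q : H} {k b L : ℝ} {α β : ℕ → ℝ}

theorem k_mul_alpha_le (h : IsHpaScheme Q PQ T G q k b L α β) :
    ∀ᶠ n in atTop, k * α n ≤ 1 := by
  have : Tendsto (fun n => k * α n) atTop (nhds 0) := by
    simpa using h.alpha_tendsto.const_mul k
  exact this.eventually_le_const one_pos

theorem proj_eq (h : IsHpaScheme Q PQ T G q k b L α β) : PQ q = q :=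
  (sub_eq_zero.1 (real_inner_self_nonpos.1 ((h.proj q).2 q h.q_mem))).symm

theorem mem (h : IsHpaScheme Q PQ T G q k b L α β) {x : ℕ → H} (hx0 : x 0 ∈ Q)
    (hrec : ∀ n, ∃ u, x (n + 1) = β n • x n + (1 - β n) • PQ u) (n : ℕ) : x n ∈ Q := by
  induction n with
  | zero => exact hx0
  | succ n ih =>
    obtain ⟨u, hu⟩ := hrec n
    rw [hu]
    exact h.convex ih (h.proj u).1 (h.beta_mem n).1 (by linarith [(h.beta_mem n).2]) (by ring)

theorem norm_proj_sub_proj_le (h : IsHpaScheme Q PQ T G q k b L α β) :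
    ∀ᶠ n in atTop, ∀ x ∈ Q, ∀ y ∈ Q,
      ‖PQ (T x + α n • G x) - PQ (T y + α n • G y)‖ ≤ (1 - k * α n) * ‖x - y‖ := by
  filter_upwards [h.contr] with n hn x hx y hy
  exact (norm_sub_le_of_proj h.proj _ _).trans (hn x hx y hy)

theorem norm_proj_sub_le (h : IsHpaScheme Q PQ T G q k b L α β) :
    ∀ᶠ n in atTop, ∀ x ∈ Q,
      ‖PQ (T x + α n • G x) - q‖ ≤ (1 - k * α n) * ‖x - q‖ + α n * ‖G q‖ := by
  filter_upwards [h.contr] with n hn x hx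
  have h1 := norm_sub_le_of_proj h.proj (T x + α n • G x) q
  have h2 := hn x hx q h.q_mem
  rw [h.proj_eq] at h1
  rw [h.q_fixed] at h2
  have h3 : T x + α n • G x - q = (T x + α n • G x - (q + α n • G q)) + α n • G q := by abel
  have h4 := norm_add_le (T x + α n • G x - (q + α n • G q)) (α n • G q)
  rw [norm_smul, Real.norm_of_nonneg (h.alpha_mem n).1.le, ← h3] at h4
  linarith

theorem one_sub_mul_le (h : IsHpaScheme Q PQ T G q k b L α β) :
    ∀ᶠ n in atTop, ∀ t : ℝ, 0 ≤ t →
      β n * t + (1 - β n) * ((1 - k * α n) * t) ≤ (1 - b * k * α n) * t := by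
  filter_upwards [h.beta_le] with n hn t ht
  have : b * (k * α n * t) ≤ (1 - β n) * (k * α n * t) :=
    mul_le_mul_of_nonneg_right (by linarith)
      (mul_nonneg (mul_nonneg h.k_pos.le (h.alpha_mem n).1.le) ht)
  linarith

theorem norm_combination_le (h : IsHpaScheme Q PQ T G q k b L α β) (n : ℕ) (u v : H) :
    ‖β n • u + (1 - β n) • v‖ ≤ β n * ‖u‖ + (1 - β n) * ‖v‖ := by
  have h1 := norm_add_le (β n • u) ((1 - β n) • v)
  rwa [norm_smul, norm_smul, Real.norm_of_nonneg (h.beta_mem n).1,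
    Real.norm_of_nonneg (by linarith [(h.beta_mem n).2])] at h1

theorem bounded (h : IsHpaScheme Q PQ T G q k b L α β) {x : ℕ → H} (hxQ : ∀ n, x n ∈ Q)
    (hrec : ∀ n, x (n + 1) = hpaStep PQ T G (α n) (β n) (x n)) :
    ∃ R, 0 < R ∧ ∀ᶠ n in atTop, ‖x n - q‖ ≤ R ∧ ‖PQ (T (x n) + α n • G (x n)) - q‖ ≤ R := by
  obtain ⟨N, hN⟩ := eventually_atTop.1 (h.norm_proj_sub_le.and h.k_mul_alpha_le)
  set R := max (‖x N - q‖ + 1) (‖G q‖ / k) with hR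
  have hRpos : 0 < R := lt_max_of_lt_left (by positivity)
  have hD : ‖G q‖ ≤ k * R := by
    have := le_max_right (‖x N - q‖ + 1) (‖G q‖ / k)
    rwa [← hR, div_le_iff₀ h.k_pos, mul_comm] at this
  have hy : ∀ n ≥ N, ‖x n - q‖ ≤ R → ‖PQ (T (x n) + α n • G (x n)) - q‖ ≤ R := by
    intro n hn hx
    obtain ⟨h1, h2⟩ := hN n hn
    calc _ ≤ _ := h1 _ (hxQ n)
      _ ≤ (1 - k * α n) * R + α n * (k * R) := by
        have := (h.alpha_mem n).1.le
        have : 0 ≤ 1 - k * α n := by linarith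
        gcongr
      _ = R := by ring
  have hx : ∀ n ≥ N, ‖x n - q‖ ≤ R := by
    intro n hn
    induction n, hn using Nat.le_induction with
    | base => exact (by linarith : ‖x N - q‖ ≤ ‖x N - q‖ + 1).trans (le_max_left _ _)
    | succ n hn ih =>
      have h3 : x (n + 1) - q
          = β n • (x n - q) + (1 - β n) • (PQ (T (x n) + α n • G (x n)) - q) := by
        rw [hrec, hpaStep]
        module
      rw [h3]
      have := (h.beta_mem n).1
      have : 0 ≤ 1 - β n := by linarith [(h.beta_mem n).2]
      calc _ ≤ _ := h.norm_combination_le n _ _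
        _ ≤ β n * R + (1 - β n) * R := by
          gcongr
          exact hy n hn ih
        _ = R := by ring
  refine ⟨R, hRpos, ?_⟩
  filter_upwards [eventually_ge_atTop N] with n hn
  exact ⟨hx n hn, hy n hn (hx n hn)⟩

theorem norm_apply_le (h : IsHpaScheme Q PQ T G q k b L α β) {R : ℝ} {z : H} (hz : z ∈ Q)
    (hzR : ‖z - q‖ ≤ R) : ‖G z‖ ≤ L * R + ‖G q‖ := by
  have h1 := h.lip z hz q h.q_mem
  have h2 := mul_le_mul_of_nonneg_left hzR h.lip_nonneg
  have h3 := norm_sub_norm_le (G z) (G q)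
  linarith

theorem norm_proj_sub_proj_param_le (h : IsHpaScheme Q PQ T G q k b L α β) {R : ℝ} {z : H}
    (hz : z ∈ Q) (hzR : ‖z - q‖ ≤ R) (s t : ℝ) :
    ‖PQ (T z + s • G z) - PQ (T z + t • G z)‖ ≤ |s - t| * (L * R + ‖G q‖) := by
  refine (norm_sub_le_of_proj h.proj _ _).trans ?_
  rw [add_sub_add_left_eq_sub, ← sub_smul, norm_smul, Real.norm_eq_abs]
  exact mul_le_mul_of_nonneg_left (h.norm_apply_le hz hzR) (abs_nonneg _)

theorem norm_sq_proj_sub_le (h : IsHpaScheme Q PQ T G q k b L α β) :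
    ∀ᶠ n in atTop, ∀ x ∈ Q,
      ‖PQ (T x + α n • G x) - q‖ ^ 2 ≤ (1 - k * α n) * ‖x - q‖ ^ 2
        + 2 * α n * ⟪G q, PQ (T x + α n • G x) - q⟫ := by
  filter_upwards [h.contr, h.k_mul_alpha_le] with n hn hk x hx
  set u := T x + α n • G x
  have h1 : ‖PQ u - q‖ ^ 2 ≤ ⟪u - q, PQ u - q⟫ := by
    have e1 : ⟪u - PQ u, q - PQ u⟫ = -⟪u - PQ u, PQ u - q⟫ := by
      rw [← inner_neg_right, neg_sub]
    have e2 := (h.proj u).2 q h.q_mem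
    rw [← sub_add_sub_cancel u (PQ u) q, inner_add_left, real_inner_self_eq_norm_sq]
    linarith
  have h2 : u - q = (u - (T q + α n • G q)) + α n • G q := by
    rw [h.q_fixed]
    abel
  rw [h2, inner_add_left, real_inner_smul_left] at h1
  have h3 := (real_inner_le_norm (u - (T q + α n • G q)) (PQ u - q)).trans
    (mul_le_mul_of_nonneg_right (hn x hx q h.q_mem) (norm_nonneg _))
  have hc : 0 ≤ 1 - k * α n := by linarith
  have hc1 : (1 - k * α n) ^ 2 * ‖x - q‖ ^ 2 ≤ (1 - k * α n) * ‖x - q‖ ^ 2 := by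
    have := mul_nonneg h.k_pos.le (h.alpha_mem n).1.le
    have : (1 - k * α n) ^ 2 ≤ 1 - k * α n := by nlinarith
    gcongr
  nlinarith [sq_nonneg ((1 - k * α n) * ‖x - q‖ - ‖PQ u - q‖)]

theorem tendsto [CompleteSpace H] (h : IsHpaScheme Q PQ T G q k b L α β) {x : ℕ → H}
    (hxQ : ∀ n, x n ∈ Q) (hrec : ∀ n, x (n + 1) = hpaStep PQ T G (α n) (β n) (x n))
    (hreg : ∀ σ > 0, ∃ τ > 0, ∀ᶠ n in atTop,
      β n * (1 - β n) * ‖x n - PQ (T (x n) + α n • G (x n))‖ ^ 2 ≤ τ →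
        ‖x n - PQ (T (x n) + α n • G (x n))‖ ≤ σ) :
    Tendsto x atTop (nhds q) := by
  obtain ⟨R, hR, hbdd⟩ := h.bounded hxQ hrec
  set y : ℕ → H := fun n => PQ (T (x n) + α n • G (x n)) with hy
  have hyQ : ∀ n, y n ∈ Q := fun n => (h.proj _).1
  set ρ : ℕ → ℝ := fun n => β n * (1 - β n) * ‖x n - y n‖ ^ 2 with hρ
  have hρ0 : ∀ n, 0 ≤ ρ n := fun n =>
    mul_nonneg (mul_nonneg (h.beta_mem n).1 (by linarith [(h.beta_mem n).2])) (sq_nonneg _)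
  have hyT : ∀ᶠ n in atTop,
      ‖y n - T (y n)‖ ≤ α n * (L * R + ‖G q‖) + ‖x n - y n‖ := by
    filter_upwards [hbdd] with n hn
    have h1 : ‖y n - T (x n)‖ ≤ α n * (L * R + ‖G q‖) := by
      have e1 : PQ (T (x n)) = T (x n) := (sub_eq_zero.1 (real_inner_self_nonpos.1
        ((h.proj (T (x n))).2 _ (h.mapsTo _ (hxQ n))))).symm
      have := h.norm_proj_sub_proj_param_le (hxQ n) hn.1 (α n) 0
      rwa [zero_smul, add_zero, e1, sub_zero, abs_of_pos (h.alpha_mem n).1] at this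
    exact (norm_sub_le_norm_sub_add_norm_sub _ (T (x n)) _).trans
      (add_le_add h1 (h.nonexp _ (hxQ n) _ (hyQ n)))
  have hdem : ∀ δ > 0, ∃ τ > 0, ∀ᶠ n in atTop, ρ n ≤ τ → ⟪G q, y n - q⟫ ≤ δ := by
    intro δ hδ
    obtain ⟨σ, hσ, hσ'⟩ := exists_inner_le_of_norm_sub_le h.nonexp h.proj h.vip R hδ
    obtain ⟨τ, hτ, hτ'⟩ := hreg (σ / 2) (half_pos hσ)
    refine ⟨τ, hτ, ?_⟩
    have hαK : Tendsto (fun n => α n * (L * R + ‖G q‖)) atTop (nhds 0) := by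
      simpa using h.alpha_tendsto.mul_const (L * R + ‖G q‖)
    filter_upwards [hτ', hyT, hbdd, hαK.eventually_le_const (half_pos hσ)] with n h1 h2 h3 h4 h5
    exact hσ' _ (hyQ n) h3.2 (by linarith [h1 h5])
  have hneg : IsNegligible α
      (fun n => max 0 ((1 - β n) * (2 * α n * ⟪G q, y n - q⟫) - ρ n)) := by
    refine ⟨fun _ => 0, fun _ => le_rfl, summable_zero, fun δ hδ => ?_⟩
    obtain ⟨τ, hτ, hτ'⟩ := hdem (δ / 2) (half_pos hδ)
    have hαK : Tendsto (fun n => 2 * α n * (‖G q‖ * R)) atTop (nhds 0) := by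
      simpa using (h.alpha_tendsto.const_mul 2).mul_const (‖G q‖ * R)
    filter_upwards [hτ', hbdd, hαK.eventually_le_const hτ] with n h1 h2 h3
    have hα := (h.alpha_mem n).1
    have hβ0 := (h.beta_mem n).1
    have hβ1 : 0 ≤ 1 - β n := by linarith [(h.beta_mem n).2]
    rw [add_zero]
    refine max_le (by positivity) ?_
    rcases le_or_gt (ρ n) τ with h4 | h4
    · have h5 : 2 * α n * ⟪G q, y n - q⟫ ≤ 2 * α n * (δ / 2) := by
        gcongr
        exact h1 h4
      have h6 := mul_le_mul_of_nonneg_left h5 hβ1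
      have h7 : (1 - β n) * (2 * α n * (δ / 2)) ≤ 1 * (2 * α n * (δ / 2)) := by
        gcongr
        linarith
      linarith [hρ0 n]
    · have h5 : 2 * α n * ⟪G q, y n - q⟫ ≤ 2 * α n * (‖G q‖ * R) := by
        gcongr
        exact (real_inner_le_norm _ _).trans (by gcongr; exact h2.2)
      have h6 := mul_le_mul_of_nonneg_left (h5.trans h3) hβ1
      have h7 : (1 - β n) * τ ≤ 1 * τ := by
        gcongr
        linarith
      have : 0 ≤ δ * α n := by positivity
      linarith
  have hlim : Tendsto (fun n => ‖x n - q‖ ^ 2) atTop (nhds 0) := by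
    refine tendsto_zero_of_succ_le_of_isNegligible (mul_pos h.b_pos h.k_pos)
      (fun n => (h.alpha_mem n).1) h.alpha_tendsto h.alpha_sum (fun n => sq_nonneg _) hneg ?_
    filter_upwards [h.norm_sq_proj_sub_le, h.one_sub_mul_le] with n h1 h2
    have h3 : x (n + 1) - q = β n • (x n - q) + (1 - β n) • (y n - q) := by
      rw [hrec, hpaStep]
      module
    have h4 : ‖x (n + 1) - q‖ ^ 2
        = β n * ‖x n - q‖ ^ 2 + (1 - β n) * ‖y n - q‖ ^ 2 - ρ n := by
      have e1 : ‖x n - y n‖ ^ 2 = ‖x n - q‖ ^ 2 - 2 * ⟪x n - q, y n - q⟫ + ‖y n - q‖ ^ 2 := by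
        rw [← norm_sub_sq_real, sub_sub_sub_cancel_right]
      simp only [hρ]
      rw [h3, e1, norm_add_sq_real, real_inner_smul_left,
        real_inner_smul_right, norm_smul, norm_smul, mul_pow, mul_pow, Real.norm_eq_abs,
        Real.norm_eq_abs, sq_abs, sq_abs]
      ring
    have hβ1 : 0 ≤ 1 - β n := by linarith [(h.beta_mem n).2]
    have h5 := mul_le_mul_of_nonneg_left (h1 _ (hxQ n)) hβ1
    have h6 := h2 (‖x n - q‖ ^ 2) (sq_nonneg _)
    have h7 := le_max_right 0 ((1 - β n) * (2 * α n * ⟪G q, y n - q⟫) - ρ n)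
    rw [h4]
    simp only [hy] at h5 h7 ⊢
    linarith
  rw [tendsto_iff_norm_sub_tendsto_zero]
  simpa using hlim.sqrt

theorem tendsto_succ_sub (h : IsHpaScheme Q PQ T G q k b L α β) {x : ℕ → H}
    (hxQ : ∀ n, x n ∈ Q) (hrec : ∀ n, x (n + 1) = hpaStep PQ T G (α n) (β n) (x n))
    (hαβ : IsNegligible α fun n => |β (n + 1) - β n| + |α (n + 1) - α n|) :
    Tendsto (fun n => ‖x (n + 1) - x n‖) atTop (nhds 0) := by
  obtain ⟨R, hR, hbdd⟩ := h.bounded hxQ hrec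
  have hL := h.lip_nonneg
  set K := 2 * R + (L * R + ‖G q‖) + ‖G q‖ with hK
  have hLR : 0 ≤ L * R + ‖G q‖ := by positivity
  have hKpos : 0 < K := by positivity
  refine tendsto_zero_of_succ_le_of_isNegligible (mul_pos h.b_pos h.k_pos)
    (fun n => (h.alpha_mem n).1) h.alpha_tendsto h.alpha_sum (fun n => norm_nonneg _)
    (hαβ.const_mul hKpos) ?_
  filter_upwards [h.norm_proj_sub_proj_le, h.norm_proj_sub_le, h.k_mul_alpha_le,
    h.one_sub_mul_le, (tendsto_add_atTop_nat 1).eventually hbdd] with n h1 h2 h3 h4 h5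
  set w := PQ (T (x (n + 1)) + α n • G (x (n + 1))) with hw
  set y := PQ (T (x n) + α n • G (x n)) with hy
  set y' := PQ (T (x (n + 1)) + α (n + 1) • G (x (n + 1))) with hy'
  have hα0 := (h.alpha_mem n).1
  have hα1 := (h.alpha_mem n).2
  have hβ1 : 0 ≤ 1 - β n := by linarith [(h.beta_mem n).2]
  have e : x (n + 1 + 1) - x (n + 1) = (β n • (x (n + 1) - x n) + (1 - β n) • (w - y))
      + ((β (n + 1) - β n) • (x (n + 1) - w) + (1 - β (n + 1)) • (y' - w)) := by
    have e1 : x (n + 1 + 1) = β (n + 1) • x (n + 1) + (1 - β (n + 1)) • y' := hrec (n + 1)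
    have e2 : x (n + 1) - (β n • x n + (1 - β n) • y) = 0 := sub_eq_zero.2 (hrec n)
    rw [e1, ← sub_eq_zero, ← neg_eq_zero, ← e2]
    module
  have hwy : ‖w - y‖ ≤ (1 - k * α n) * ‖x (n + 1) - x n‖ := h1 _ (hxQ _) _ (hxQ _)
  have hyw : ‖y' - w‖ ≤ |α (n + 1) - α n| * (L * R + ‖G q‖) :=
    h.norm_proj_sub_proj_param_le (hxQ _) h5.1 _ _
  have hwq : ‖w - q‖ ≤ R + ‖G q‖ := by
    have a1 := h2 _ (hxQ (n + 1))
    have a2 : (1 - k * α n) * ‖x (n + 1) - q‖ ≤ 1 * R := by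
      have := mul_pos h.k_pos hα0
      gcongr
      · linarith
      · exact h5.1
    have a3 : α n * ‖G q‖ ≤ 1 * ‖G q‖ := by gcongr
    linarith
  have hxw : ‖x (n + 1) - w‖ ≤ K := by
    have a1 := norm_sub_le_norm_sub_add_norm_sub (x (n + 1)) q w
    rw [norm_sub_rev q w] at a1
    linarith [h5.1]
  have b1 := h.norm_combination_le n (x (n + 1) - x n) (w - y)
  have b2 := mul_le_mul_of_nonneg_left hwy hβ1
  have b3 := h4 _ (norm_nonneg (x (n + 1) - x n))
  have b4 : ‖(β (n + 1) - β n) • (x (n + 1) - w)‖ ≤ |β (n + 1) - β n| * K := by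
    rw [norm_smul, Real.norm_eq_abs]
    gcongr
  have b5 : ‖(1 - β (n + 1)) • (y' - w)‖ ≤ |α (n + 1) - α n| * K := by
    have hc : 0 ≤ 1 - β (n + 1) := by linarith [(h.beta_mem (n + 1)).2]
    rw [norm_smul, Real.norm_of_nonneg hc]
    calc (1 - β (n + 1)) * ‖y' - w‖ ≤ 1 * ‖y' - w‖ := by
          gcongr
          linarith [(h.beta_mem (n + 1)).1]
      _ ≤ |α (n + 1) - α n| * (L * R + ‖G q‖) := by rwa [one_mul]
      _ ≤ |α (n + 1) - α n| * K := by
          gcongr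
          linarith [norm_nonneg (G q)]
  rw [e]
  have b6 := norm_add_le (β n • (x (n + 1) - x n) + (1 - β n) • (w - y))
    ((β (n + 1) - β n) • (x (n + 1) - w) + (1 - β (n + 1)) • (y' - w))
  have b7 := norm_add_le ((β (n + 1) - β n) • (x (n + 1) - w)) ((1 - β (n + 1)) • (y' - w))
  linarith

theorem tendsto_sub_of_tendsto_succ_sub (h : IsHpaScheme Q PQ T G q k b L α β) {x : ℕ → H}
    (hrec : ∀ n, x (n + 1) = hpaStep PQ T G (α n) (β n) (x n))
    (hx : Tendsto (fun n => ‖x (n + 1) - x n‖) atTop (nhds 0)) :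
    Tendsto (fun n => ‖x n - PQ (T (x n) + α n • G (x n))‖) atTop (nhds 0) := by
  have hlim : Tendsto (fun n => b⁻¹ * ‖x (n + 1) - x n‖) atTop (nhds 0) := by
    simpa using hx.const_mul b⁻¹
  refine squeeze_zero' (Eventually.of_forall fun n => norm_nonneg _) ?_ hlim
  filter_upwards [h.beta_le] with n hn
  have e : x (n + 1) - x n = -((1 - β n) • (x n - PQ (T (x n) + α n • G (x n)))) := by
    rw [hrec, hpaStep]
    module
  rw [e, norm_neg, norm_smul, Real.norm_of_nonneg (by linarith [h.b_pos]),
    le_inv_mul_iff₀ h.b_pos]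
  gcongr
  linarith

theorem tendsto_sub_of_error (h : IsHpaScheme Q PQ T G q k b L α β) {x x' e : ℕ → H}
    (hxQ : ∀ n, x n ∈ Q) (hxQ' : ∀ n, x' n ∈ Q)
    (hrec : ∀ n, x (n + 1) = β n • x n + (1 - β n) • PQ (T (x n) + α n • G (x n) + e n))
    (hrec' : ∀ n, x' (n + 1) = hpaStep PQ T G (α n) (β n) (x' n))
    (he : IsNegligible α fun n => ‖e n‖) :
    Tendsto (fun n => ‖x n - x' n‖) atTop (nhds 0) := by
  refine tendsto_zero_of_succ_le_of_isNegligible (mul_pos h.b_pos h.k_pos)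
    (fun n => (h.alpha_mem n).1) h.alpha_tendsto h.alpha_sum (fun n => norm_nonneg _) he ?_
  filter_upwards [h.contr, h.one_sub_mul_le] with n h1 h2
  set u := T (x n) + α n • G (x n)
  set u' := T (x' n) + α n • G (x' n)
  have e1 : x (n + 1) - x' (n + 1) = β n • (x n - x' n) + (1 - β n) • (PQ (u + e n) - PQ u') := by
    rw [hrec, hrec', hpaStep]
    module
  have hβ1 : 0 ≤ 1 - β n := by linarith [(h.beta_mem n).2]
  have h3 : ‖PQ (u + e n) - PQ u'‖ ≤ (1 - k * α n) * ‖x n - x' n‖ + ‖e n‖ := by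
    have e2 : u + e n - u' = (u - u') + e n := by abel
    have := norm_sub_le_of_proj h.proj (u + e n) u'
    rw [e2] at this
    linarith [norm_add_le (u - u') (e n), h1 _ (hxQ n) _ (hxQ' n)]
  have h4 := h.norm_combination_le n (x n - x' n) (PQ (u + e n) - PQ u')
  have h5 := mul_le_mul_of_nonneg_left h3 hβ1
  have h6 := h2 _ (norm_nonneg (x n - x' n))
  have h7 := mul_nonneg (h.beta_mem n).1 (norm_nonneg (e n))
  rw [e1]
  linarith

end IsHpaScheme

end Hilbert

open Filter

/-- Theorem of Section 5, first part: in the limit case `α = η`, the regularized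
algorithm converges strongly to the unique solution `q^ε` of the regularized
variational inequality problem (VIP_ε) on `C = Fix(T)`. -/
theorem regularized_hpa_convergence
    {H : Type*} [NormedAddCommGroup H] [InnerProductSpace ℝ H] [CompleteSpace H]
    (Q : Set H) (hQne : Q.Nonempty) (hQclosed : IsClosed Q) (hQconvex : Convex ℝ Q)
    (T f F : H → H)
    (hTmaps : ∀ x ∈ Q, T x ∈ Q)
    (hTnonexp : ∀ x ∈ Q, ∀ y ∈ Q, ‖T x - T y‖ ≤ ‖x - y‖)
    (C : Set H) (hC : C = {x | x ∈ Q ∧ T x = x}) (hCne : C.Nonempty)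
    (κ η : ℝ) (hκ : 0 < κ) (hη : 0 < η)
    (hfLip : ∀ x ∈ Q, ∀ y ∈ Q, ‖f x - f y‖ ≤ η * ‖x - y‖)
    (hFLip : ∀ x ∈ Q, ∀ y ∈ Q, ‖F x - F y‖ ≤ κ * ‖x - y‖)
    (hFmono : ∀ x ∈ Q, ∀ y ∈ Q, η * ‖x - y‖ ^ 2 ≤ ⟪F x - F y, x - y⟫)
    (PQ : H → H)
    (hPQ : ∀ x : H, PQ x ∈ Q ∧ ∀ y ∈ Q, ⟪x - PQ x, y - PQ x⟫ ≤ 0)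
    (ε : ℝ) (hε : 0 < ε)
    (e : ℕ → H) (α β : ℕ → ℝ)
    (hα : ∀ n, α n ∈ Set.Ioc (0 : ℝ) 1)
    (hβ : ∀ n, β n ∈ Set.Icc (0 : ℝ) 1)
    (hα0 : Tendsto α atTop (nhds 0))
    (hαsum : Tendsto (fun n => ∑ i ∈ Finset.range n, α i) atTop atTop)
    (hβcond :
      (0 < liminf β atTop ∧ limsup β atTop < 1)
      ∨ (limsup β atTop < 1
          ∧ (Tendsto (fun n => (β (n + 1) - β n) / α n) atTop (nhds 0)
              ∨ Summable fun n => |β (n + 1) - β n|)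
          ∧ (Tendsto (fun n => (α (n + 1) - α n) / α n) atTop (nhds 0)
              ∨ Summable fun n => |α (n + 1) - α n|)))
    (he : (Summable fun n => ‖e n‖) ∨ Tendsto (fun n => ‖e n‖ / α n) atTop (nhds 0))
    (x : ℕ → H) (hx0 : x 0 ∈ Q)
    (hrec : ∀ n, x (n + 1) = β n • x n
      + (1 - β n) • PQ (α n • f (x n)
          + (1 - α n * ε) • T (x n) - α n • F (T (x n)) + e n))
    (qε : H) (hqεC : qε ∈ C)
    (hqεVIP : ∀ p ∈ C, 0 ≤ ⟪F qε + ε • qε - f qε, p - qε⟫) :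
    Tendsto x atTop (nhds qε) := by
  subst hC
  obtain ⟨hqQ, hqT⟩ := hqεC
  have hβbdd : IsBoundedUnder (· ≤ ·) atTop β :=
    isBoundedUnder_of ⟨1, fun n => (hβ n).2⟩
  have hβbdd' : IsBoundedUnder (· ≥ ·) atTop β :=
    isBoundedUnder_of ⟨0, fun n => (hβ n).1⟩
  have hlimsup : limsup β atTop < 1 := hβcond.elim (·.2) (·.1)
  obtain ⟨c, hc, hc1⟩ := exists_between hlimsup
  have hβc : ∀ᶠ n in atTop, β n ≤ 1 - (1 - c) := by
    filter_upwards [eventually_lt_of_limsup_lt hc hβbdd] with n hn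
    linarith
  set G : H → H := fun z => f z - ε • T z - F (T z) with hG
  have hαle (M : ℝ) {ν : ℝ} (hν : 0 < ν) : ∀ᶠ n in atTop, α n * M ≤ ν := by
    have : Tendsto (fun n => α n * M) atTop (nhds 0) := by simpa using hα0.mul_const M
    exact this.eventually_le_const hν
  have h : IsHpaScheme Q PQ T G qε (ε / 2) (1 - c) (η + ε + κ) α β :=
    { convex := hQconvex
      mapsTo := hTmaps
      nonexp := hTnonexp
      proj := hPQ
      lip_nonneg := by positivity
      lip := fun u hu v hv => by
        have e1 : G u - G v = (f u - f v) - ε • (T u - T v) - (F (T u) - F (T v)) := by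
          simp only [hG]
          module
        have h1 := norm_sub_le ((f u - f v) - ε • (T u - T v)) (F (T u) - F (T v))
        have h2 := norm_sub_le (f u - f v) (ε • (T u - T v))
        rw [norm_smul, Real.norm_of_nonneg hε.le] at h2
        have h3 := hTnonexp u hu v hv
        have h4 := hFLip _ (hTmaps u hu) _ (hTmaps v hv)
        rw [e1]
        linarith [hfLip u hu v hv, mul_le_mul_of_nonneg_left h3 hε.le,
          mul_le_mul_of_nonneg_left h3 hκ.le]
      q_mem := hqQ
      q_fixed := hqT
      vip := fun p hp hpT => by
        have e1 : G qε = -(F qε + ε • qε - f qε) := by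
          simp only [hG, hqT]
          abel
        rw [e1, inner_neg_left]
        linarith [hqεVIP p ⟨hp, hpT⟩]
      k_pos := by positivity
      b_pos := by linarith
      alpha_mem := hα
      alpha_tendsto := hα0
      alpha_sum := hαsum
      beta_mem := hβ
      beta_le := hβc
      contr := by
        filter_upwards [hαle (ε ^ 2 + 2 * ε * η + κ ^ 2) hε, hαle (η + ε) one_pos]
          with n h1 h2 u hu v hv
        exact norm_regularized_step_sub_le hTmaps hTnonexp hη hε hfLip hFLip hFmono
          (hα n).1.le h1 h2 hu hv }
  have hrecG : ∀ n, x (n + 1)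
      = β n • x n + (1 - β n) • PQ (T (x n) + α n • G (x n) + e n) := by
    intro n
    rw [hrec]
    congr 3
    simp only [hG]
    module
  let x' : ℕ → H := fun n => Nat.rec (x 0) (fun n z => hpaStep PQ T G (α n) (β n) z) n
  have hrec' : ∀ n, x' (n + 1) = hpaStep PQ T G (α n) (β n) (x' n) := fun n => rfl
  have hxQ : ∀ n, x n ∈ Q := h.mem hx0 fun n => ⟨_, hrecG n⟩
  have hxQ' : ∀ n, x' n ∈ Q := h.mem hx0 fun n => ⟨_, hrec' n⟩
  have hαpos : ∀ n, 0 < α n := fun n => (hα n).1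
  have herr : IsNegligible α fun n => ‖e n‖ := by
    simpa using IsNegligible.of_div_or_summable (w := fun n => ‖e n‖) hαpos
      (by simpa using he.symm)
  have hx' : Tendsto x' atTop (nhds qε) := by
    refine h.tendsto hxQ' hrec' ?_
    rcases hβcond with ⟨hinf, -⟩ | ⟨-, hβd, hαd⟩
    · obtain ⟨d, hd0, hd⟩ := exists_between hinf
      intro σ hσ
      have hc' : 0 < 1 - c := by linarith
      refine ⟨d * (1 - c) * σ ^ 2, by positivity, ?_⟩
      filter_upwards [eventually_lt_of_lt_liminf hd hβbdd', hβc] with n h1 h2 h3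
      by_contra! hlt
      have h4 : d * (1 - c) ≤ β n * (1 - β n) := by
        gcongr
        · exact (hβ n).1
        · linarith
      have h5 : d * (1 - c) * σ ^ 2
          < d * (1 - c) * ‖x' n - PQ (T (x' n) + α n • G (x' n))‖ ^ 2 := by gcongr
      have h6 := mul_le_mul_of_nonneg_right h4
        (sq_nonneg ‖x' n - PQ (T (x' n) + α n • G (x' n))‖)
      linarith
    · have hneg := (IsNegligible.of_div_or_summable (w := fun n => β (n + 1) - β n) hαpos hβd).add
        (IsNegligible.of_div_or_summable (w := fun n => α (n + 1) - α n) hαpos hαd)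
      have hlim := h.tendsto_sub_of_tendsto_succ_sub hrec' (h.tendsto_succ_sub hxQ' hrec' hneg)
      intro σ hσ
      refine ⟨1, one_pos, ?_⟩
      filter_upwards [hlim.eventually_le_const hσ] with n hn _ using hn
  have hdiff := h.tendsto_sub_of_error hxQ hxQ' hrecG hrec' herr
  simpa using (tendsto_zero_iff_norm_tendsto_zero.2 hdiff).add hx'
end
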